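/- Let a ≥ 2 be an integer and let p ∈ (0,1) be a rational number. Let T₁ = Σ_{i₁=1}^{2} Σ_{i₂=1}^{2} Σ_{i₃=1}^{a+2} e_{i₁} ⊗ e_{i₂} ⊗ e_{i₃} ⊗ e_{(i₁,i₂,i₃)} ∈ ℂ² ⊗ ℂ² ⊗ ℂ^{a+2} ⊗ ℂ^{4(a+2)} and let T₂ = Σ_{j=1}^{a} e_j ⊗ e_j ⊗ e₀ ⊗ e₀ ∈ ℂ^a ⊗ ℂ^a ⊗ ℂ¹ ⊗ ℂ¹. Then the limit superior, over integers N → ∞ such that pN is an integer, of R̲(T₁^{⊠pN} ⊠ T₂^{⊠(1−p)N})^{1/N} is at most (4(a+2)+1) · 2^{−h(p)}. (The tensor T₁^{⊠pN} ⊠ T₂^{⊠(1−p)N} is the extended matrix multiplication tensor EMaMu(2^{pN}, 2^{pN}, a^{(1−p)N}; (a+2)^{pN}); this bound expresses the exponent bound ω(EMaMu(2,2,a^{(1−p)/p}; a+2)) ≤ (1/p)[log₂(4(a+2)+1) − h(p)].) -/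

import Mathlib

open Finset

namespace Subadditivity

noncomputable section

/-- A tensor of order `k` over `ℂ` with `i`-th factor the space `ℂ^{ι i}` of complex-valued
functions on the finite index type `ι i`; the tensor is represented by the array of its
coordinates with respect to the standard basis, i.e. by an element of
`ℂ^{ι 0} ⊗ ⋯ ⊗ ℂ^{ι (k-1)} ≃ ((∀ i, ι i) → ℂ)`. -/
abbrev Tensor {k : ℕ} (ι : Fin k → Type) : Type := (∀ i, ι i) → ℂ

/-- `T` is a sum of `r` simple (rank-one) tensors `v j 0 ⊗ ⋯ ⊗ v j (k-1)`. -/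
def HasRankLE {k : ℕ} {ι : Fin k → Type} (T : Tensor ι) (r : ℕ) : Prop :=
  ∃ v : Fin r → (∀ i, ι i → ℂ), T = fun x => ∑ j : Fin r, ∏ i : Fin k, v j i (x i)

/-- Tensor rank: the least `r` such that `T` is a sum of `r` simple tensors. -/
noncomputable def rank {k : ℕ} {ι : Fin k → Type} (T : Tensor ι) : ℕ :=
  sInf {r | HasRankLE T r}

/-- Border rank is at most `r`: `T` lies in the closure of the set of tensors of rank `≤ r`. -/
def HasBorderRankLE {k : ℕ} {ι : Fin k → Type} (T : Tensor ι) (r : ℕ) : Prop :=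
  T ∈ closure {S : Tensor ι | HasRankLE S r}

/-- Border rank. -/
noncomputable def borderRank {k : ℕ} {ι : Fin k → Type} (T : Tensor ι) : ℕ :=
  sInf {r | HasBorderRankLE T r}

open scoped Classical in
/-- Direct sum of two tensors of order `k`: the coordinates supported on the `ι`-part are
those of `T`, the coordinates supported on the `κ`-part are those of `S`, and all mixed
coordinates vanish. -/
noncomputable def dsum {k : ℕ} {ι κ : Fin k → Type} (T : Tensor ι) (S : Tensor κ) :
    Tensor (fun i => ι i ⊕ κ i) := fun x =>
  (if h : ∃ y : ∀ i, ι i, x = fun i => Sum.inl (y i) then T h.choose else 0) +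
  (if h : ∃ z : ∀ i, κ i, x = fun i => Sum.inr (z i) then S h.choose else 0)

/-- Kronecker product of two tensors of order `k`. -/
def kron {k : ℕ} {ι κ : Fin k → Type} (T : Tensor ι) (S : Tensor κ) :
    Tensor (fun i => ι i × κ i) := fun x =>
  T (fun i => (x i).1) * S (fun i => (x i).2)

/-- `N`-th Kronecker power of a tensor of order `k`. -/
def kpow {k : ℕ} {ι : Fin k → Type} (T : Tensor ι) (N : ℕ) :
    Tensor (fun i => Fin N → ι i) := fun x => ∏ j : Fin N, T (fun i => x i j)

/-- The unit tensor `u_k(r) = Σ_{j=1}^r e_j ⊗ ⋯ ⊗ e_j` of order `k`. -/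
def unit (k r : ℕ) : Tensor (fun _ : Fin k => Fin r) := fun x =>
  ∑ j : Fin r, ∏ i : Fin k, (if x i = j then (1 : ℂ) else 0)

/-- `S` is a degeneration of `T`: `S` lies in the closure of the set of tensors obtained
from `T` by applying linear maps `A i` on each factor. -/
def Degen {k : ℕ} {ι κ : Fin k → Type} [∀ i, Fintype (κ i)]
    (S : Tensor ι) (T : Tensor κ) : Prop :=
  S ∈ closure {S' : Tensor ι | ∃ A : ∀ i, ι i → κ i → ℂ,
    S' = fun x => ∑ y : ∀ i, κ i, (∏ i : Fin k, A i (x i) (y i)) * T y}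

/-- Kronecker delta. -/
def delta {α : Type} [DecidableEq α] (a b : α) : ℂ := if a = b then 1 else 0

/-- The order-4 "spider" tensor
`Σ_{i₁,i₂,i₃} e_{i₁} ⊗ e_{i₂} ⊗ e_{i₃} ⊗ e_{(i₁,i₂,i₃)} ∈ ℂ^{m₁} ⊗ ℂ^{m₂} ⊗ ℂ^{m₃} ⊗ ℂ^{m₁m₂m₃}`,
the last factor being indexed by triples. -/
def spider3 (m₁ m₂ m₃ : ℕ) :
    Tensor ![Fin m₁, Fin m₂, Fin m₃, Fin m₁ × Fin m₂ × Fin m₃] := fun x =>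
  delta (α := Fin m₁ × Fin m₂ × Fin m₃) (x 3) (x 0, x 1, x 2)

/-- The order-4 tensor `Σ_{j=1}^N e_j ⊗ e_j ⊗ e₀ ⊗ e₀ ∈ ℂ^N ⊗ ℂ^N ⊗ ℂ¹ ⊗ ℂ¹`. -/
def matTensor4 (N : ℕ) : Tensor ![Fin N, Fin N, Fin 1, Fin 1] := fun x =>
  delta (α := Fin N) (x 0) (x 1)

/-- The order-4 tensor `Σ_{ℓ=1}^M e_ℓ ⊗ e_ℓ ⊗ e_ℓ ⊗ e₀ ∈ ℂ^M ⊗ ℂ^M ⊗ ℂ^M ⊗ ℂ¹`. -/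
def ghz4 (M : ℕ) : Tensor ![Fin M, Fin M, Fin M, Fin 1] := fun x =>
  delta (α := Fin M) (x 0) (x 1) * delta (α := Fin M) (x 1) (x 2)

/-- The binary entropy function `h(p) = −p·log₂ p − (1−p)·log₂(1−p)`. -/
def binEnt (p : ℚ) : ℝ :=
  -(p : ℝ) * Real.logb 2 (p : ℝ) - (1 - (p : ℝ)) * Real.logb 2 (1 - (p : ℝ))

/-- The filter of integers `N → ∞` such that `p·N` is an integer. -/
def pIntFilter (p : ℚ) : Filter ℕ :=
  Filter.atTop ⊓ Filter.principal {N : ℕ | ∃ m : ℕ, (m : ℚ) = p * N}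

section Rank

variable {k : ℕ} {ι κ : Fin k → Type}

lemma hasRankLE_sum {J : Type} [Fintype J] (v : J → ∀ i, ι i → ℂ) :
    HasRankLE (fun x => ∑ j, ∏ i, v j i (x i)) (Fintype.card J) := by
  refine ⟨fun j => v ((Fintype.equivFin J).symm j), funext fun x => ?_⟩
  exact (Equiv.sum_comp (Fintype.equivFin J).symm fun j => ∏ i, v j i (x i)).symm

lemma HasRankLE.exists_sum {T : Tensor ι} {r : ℕ} (h : HasRankLE T r) {J : Type} [Fintype J]
    (hJ : Fintype.card J = r) :
    ∃ v : J → ∀ i, ι i → ℂ, T = fun x => ∑ j, ∏ i, v j i (x i) := by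
  obtain ⟨v, rfl⟩ := h
  refine ⟨fun j => v (Fintype.equivFinOfCardEq hJ j), funext fun x => ?_⟩
  exact (Equiv.sum_comp (Fintype.equivFinOfCardEq hJ) fun j => ∏ i, v j i (x i)).symm

lemma HasRankLE.add {T S : Tensor ι} {r s : ℕ} (hT : HasRankLE T r) (hS : HasRankLE S s) :
    HasRankLE (fun x => T x + S x) (r + s) := by
  obtain ⟨v, rfl⟩ := hT
  obtain ⟨w, rfl⟩ := hS
  simpa using hasRankLE_sum (J := Fin r ⊕ Fin s) (Sum.elim v w)

lemma hasRankLE_zero [NeZero k] (r : ℕ) : HasRankLE (fun _ => 0 : Tensor ι) r :=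
  ⟨fun _ _ _ => 0, by simp [NeZero.ne k]⟩

lemma HasRankLE.mono [NeZero k] {T : Tensor ι} {r s : ℕ} (hT : HasRankLE T r) (h : r ≤ s) :
    HasRankLE T s := by
  simpa [Nat.add_sub_cancel' h] using hT.add (hasRankLE_zero (s - r))

lemma HasRankLE.comp {T : Tensor ι} {r : ℕ} (hT : HasRankLE T r) (f : ∀ i, κ i → ι i) :
    HasRankLE (fun x => T fun i => f i (x i)) r := by
  obtain ⟨v, rfl⟩ := hT
  exact ⟨fun j i x => v j i (f i x), rfl⟩

lemma HasRankLE.kpow {T : Tensor ι} {r : ℕ} (hT : HasRankLE T r) (N : ℕ) :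
    HasRankLE (kpow T N) (r ^ N) := by
  obtain ⟨v, rfl⟩ := hT
  have := hasRankLE_sum (ι := fun i => Fin N → ι i) (J := Fin N → Fin r)
    fun l i x => ∏ j, v (l j) i (x j)
  rw [Fintype.card_fun, Fintype.card_fin, Fintype.card_fin] at this
  convert this using 2 with x
  rw [Subadditivity.kpow, Finset.prod_univ_sum]
  simp only [Fintype.piFinset_univ]
  exact Finset.sum_congr rfl fun l _ => Finset.prod_comm

lemma HasRankLE.hasBorderRankLE {T : Tensor ι} {r : ℕ} (hT : HasRankLE T r) :
    HasBorderRankLE T r :=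
  subset_closure hT

lemma HasBorderRankLE.borderRank_le {T : Tensor ι} {r : ℕ} (hT : HasBorderRankLE T r) :
    borderRank T ≤ r :=
  Nat.sInf_le hT

lemma HasBorderRankLE.mono [NeZero k] {T : Tensor ι} {r s : ℕ} (hT : HasBorderRankLE T r)
    (h : r ≤ s) : HasBorderRankLE T s :=
  closure_mono (fun _ hS => HasRankLE.mono hS h) hT

lemma HasBorderRankLE.comp {T : Tensor ι} {r : ℕ} (hT : HasBorderRankLE T r)
    (f : ∀ i, κ i → ι i) : HasBorderRankLE (fun x => T fun i => f i (x i)) r :=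
  map_mem_closure (f := fun (T : Tensor ι) (x : ∀ i, κ i) => T fun i => f i (x i))
    (by fun_prop) hT fun _ hS => HasRankLE.comp hS f

lemma HasBorderRankLE.kpow {T : Tensor ι} {r : ℕ} (hT : HasBorderRankLE T r) (N : ℕ) :
    HasBorderRankLE (kpow T N) (r ^ N) :=
  map_mem_closure (f := fun T : Tensor ι => Subadditivity.kpow T N)
    (by unfold Subadditivity.kpow; fun_prop) hT fun _ hS => HasRankLE.kpow hS N

lemma HasBorderRankLE.add {T S : Tensor ι} {r s : ℕ} (hT : HasBorderRankLE T r)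
    (hS : HasBorderRankLE S s) : HasBorderRankLE (fun x => T x + S x) (r + s) :=
  map_mem_closure₂ (f := fun (T S : Tensor ι) (x : ∀ i, ι i) => T x + S x)
    (by fun_prop) hT hS fun _ hT _ hS => HasRankLE.add hT hS

lemma HasBorderRankLE.sum [NeZero k] {J : Type} {F : J → Tensor ι} {r : ℕ}
    (s : Finset J) (hF : ∀ j, HasBorderRankLE (F j) r) :
    HasBorderRankLE (fun x => ∑ j ∈ s, F j x) (s.card * r) := by
  classical
  induction s using Finset.induction_on with
  | empty => simpa using (hasRankLE_zero 0).hasBorderRankLE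
  | insert j s hj ih =>
    simp only [Finset.sum_insert hj, Finset.card_insert_of_notMem hj]
    convert (hF j).add ih using 1
    ring

end Rank

section Diagonal

variable {k : ℕ} {ι κ : Fin k → Type} {Q : Type} [Fintype Q] [DecidableEq Q]

/-- The unit tensor of order `k` whose factors are all indexed by `Q`. -/
def diag (k : ℕ) (Q : Type) [Fintype Q] [DecidableEq Q] : Tensor (fun _ : Fin k => Q) :=
  fun x => ∑ q, ∏ i, if x i = q then (1 : ℂ) else 0

lemma diag_of_forall_eq [NeZero k] {x : Fin k → Q} {q : Q} (h : ∀ i, x i = q) :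
    diag k Q x = 1 := by
  simp [diag, h, NeZero.ne k]

lemma diag_of_ne {x : Fin k → Q} {i j : Fin k} (h : x i ≠ x j) : diag k Q x = 0 := by
  refine Finset.sum_eq_zero fun q _ => ?_
  by_cases hi : x i = q
  · exact Finset.prod_eq_zero (Finset.mem_univ j) (if_neg fun hj => h (hi.trans hj.symm))
  · exact Finset.prod_eq_zero (Finset.mem_univ i) (if_neg hi)

lemma sum_prod_mul_diag (w : Q → Fin k → ℂ) :
    ∑ s : Fin k → Q, (∏ i, w (s i) i) * diag k Q s = ∑ q, ∏ i, w q i := by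
  simp only [diag, Finset.mul_sum, ← Finset.prod_mul_distrib]
  rw [Finset.sum_comm]
  refine Finset.sum_congr rfl fun q _ => ?_
  have := Finset.prod_univ_sum (fun _ : Fin k => (Finset.univ : Finset Q))
    (fun i s => w s i * if s = q then 1 else 0)
  rw [Fintype.piFinset_univ] at this
  rw [← this]
  simp

/-- Replacing the diagonal factor by the sum of the simple tensors `w q`, `q ∈ Q`. -/
lemma HasBorderRankLE.kron_sum_of_diag {A : Tensor ι} {r : ℕ}
    (hA : HasBorderRankLE (kron A (diag k Q)) r) (w : Q → ∀ i, κ i → ℂ) :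
    HasBorderRankLE (kron A fun x => ∑ q, ∏ i, w q i (x i)) r := by
  have key := map_mem_closure (t := {S | HasRankLE S r})
    (f := fun (X : Tensor fun i => ι i × Q) (x : ∀ i, ι i × κ i) =>
      ∑ s : Fin k → Q, (∏ i, w (s i) i (x i).2) * X fun i => ((x i).1, s i))
    (by fun_prop) hA (by
      rintro _ ⟨v, rfl⟩
      refine ⟨fun j i x => ∑ q, w q i x.2 * v j i (x.1, q), funext fun x => ?_⟩
      simp only [Finset.prod_univ_sum, Fintype.piFinset_univ, Finset.mul_sum,
        Finset.prod_mul_distrib]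
      exact Finset.sum_comm)
  change HasBorderRankLE _ r at key
  convert key using 1
  funext x
  simp only [kron]
  rw [← sum_prod_mul_diag fun q i => w q i (x i).2, Finset.mul_sum]
  exact Finset.sum_congr rfl fun s _ => by ring

lemma HasBorderRankLE.kron_of_diag [NeZero k] {A : Tensor ι} {B : Tensor κ} {r c : ℕ}
    (hA : HasBorderRankLE (kron A (diag k Q)) r)
    (hB : HasBorderRankLE B (Fintype.card Q * c)) :
    HasBorderRankLE (kron A B) (r * c) := by
  have key := map_mem_closure (t := {S | HasBorderRankLE S (r * c)})
    (f := fun B : Tensor κ => kron A B) (by unfold kron; fun_prop) hB ?_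
  · exact isClosed_closure.closure_subset key
  · intro S hS
    obtain ⟨v, rfl⟩ := HasRankLE.exists_sum (J := Fin c × Q) hS (by simp [mul_comm])
    have := HasBorderRankLE.sum Finset.univ
      fun b : Fin c => hA.kron_sum_of_diag fun q => v (b, q)
    rw [Finset.card_univ, Fintype.card_fin, mul_comm] at this
    change HasBorderRankLE _ _
    convert this using 1
    funext x
    simp [kron, Fintype.sum_prod_type, Finset.mul_sum]

lemma HasBorderRankLE.kron_kpow_diag [NeZero k] {T : Tensor ι} {S : Tensor κ} {m n c : ℕ}
    (h : HasBorderRankLE (kron (kron (Subadditivity.kpow T m) (Subadditivity.kpow S n)) (diag k Q))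
      (Fintype.card Q * c)) (M : ℕ) :
    HasBorderRankLE
      (kron (kron (Subadditivity.kpow T (m * M)) (Subadditivity.kpow S (n * M))) (diag k Q))
      (Fintype.card Q * c ^ M) := by
  induction M with
  | zero =>
    have := hasRankLE_sum (ι := fun i => ((Fin (m * 0) → ι i) × (Fin (n * 0) → κ i)) × Q)
      (fun (q : Q) _ x => if x.2 = q then (1 : ℂ) else 0)
    convert this.hasBorderRankLE using 1
    · funext x
      change (∏ j : Fin 0, _) * (∏ j : Fin 0, _) * _ = _
      simp [diag]
    · exact mul_one _
  | succ M ih =>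
    have := (ih.kron_of_diag h).comp
      (κ := fun i => ((Fin (m * M + m) → ι i) × (Fin (n * M + n) → κ i)) × Q)
      fun i x => ((fun j => x.1.1 (Fin.castAdd _ j), fun j => x.1.2 (Fin.castAdd _ j)),
        ((fun j => x.1.1 (Fin.natAdd _ j), fun j => x.1.2 (Fin.natAdd _ j)), x.2))
    rw [pow_succ, ← mul_assoc]
    refine (congrArg (HasBorderRankLE · _) (funext fun x => ?_)).mpr this
    change (∏ j : Fin (m * M + m), T fun i => (x i).1.1 j) *
      (∏ j : Fin (n * M + n), S fun i => (x i).1.2 j) * _ = _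
    rw [Fin.prod_univ_add, Fin.prod_univ_add]
    change _ = (∏ j, _) * (∏ j, _) * ((∏ j, _) * (∏ j, _) * _)
    ring

end Diagonal

section DirectSum

variable {k : ℕ} {ι κ : Fin k → Type}

/-- `D` is the direct sum of `T` and `S`. -/
structure IsDirectSum (D : Tensor fun i => ι i ⊕ κ i) (T : Tensor ι) (S : Tensor κ) : Prop where
  inl : ∀ y, D (fun i => Sum.inl (y i)) = T y
  inr : ∀ z, D (fun i => Sum.inr (z i)) = S z
  mixed : ∀ x i j, (x i).isLeft → (x j).isRight → D x = 0

lemma exists_equiv_sum_isLeft {m n : ℕ} (s : Finset (Fin (m + n))) (hs : s.card = m) :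
    ∃ e : Fin (m + n) ≃ Fin m ⊕ Fin n, ∀ j, (e j).isLeft ↔ j ∈ s := by
  have hc : Fintype.card {j // j ∉ s} = n := by
    rw [Fintype.card_subtype_compl]; simp [hs]
  refine ⟨(Equiv.sumCompl (· ∈ s)).symm.trans
    (Equiv.sumCongr (s.equivFinOfCardEq hs) (Fintype.equivFinOfCardEq hc)), fun j => ?_⟩
  by_cases hj : j ∈ s
  · simp [hj, Equiv.sumCompl_symm_apply_of_pos]
  · simp [hj, Equiv.sumCompl_symm_apply_of_neg]

lemma IsDirectSum.hasBorderRankLE [NeZero k] {D : Tensor fun i => ι i ⊕ κ i} {T : Tensor ι}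
    {S : Tensor κ} (hD : IsDirectSum D T S) {r : ℕ} (hr : HasBorderRankLE D r) (m n : ℕ) :
    HasBorderRankLE (kron (kron (kpow T m) (kpow S n))
      (diag k {s : Finset (Fin (m + n)) // s.card = m})) (r ^ (m + n)) := by
  choose e he using fun s : {s : Finset (Fin (m + n)) // s.card = m} =>
    exists_equiv_sum_isLeft s.1 s.2
  have := (hr.kpow (m + n)).comp
    (κ := fun i => ((Fin m → ι i) × (Fin n → κ i)) × {s : Finset (Fin (m + n)) // s.card = m})
    fun i x j => Sum.map x.1.1 x.1.2 (e x.2 j)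
  convert this using 1
  funext x
  by_cases hx : ∀ i, (x i).2 = (x 0).2
  · rw [kron, diag_of_forall_eq hx, mul_one, kpow]
    simp only [hx]
    rw [Equiv.prod_comp (e (x 0).2) fun l => D fun i => Sum.map (x i).1.1 (x i).1.2 l,
      Fintype.prod_sum_type]
    simp only [Sum.map_inl, Sum.map_inr, hD.inl fun i => (x i).1.1 _,
      hD.inr fun i => (x i).1.2 _]
    rfl
  · push Not at hx
    obtain ⟨i, hi⟩ := hx
    rw [kron, diag_of_ne hi, mul_zero, kpow]
    have hsub : ¬ (x i).2.1 ⊆ (x 0).2.1 := fun h =>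
      hi (Subtype.ext (Finset.eq_of_subset_of_card_le h (by rw [(x i).2.2, (x 0).2.2])))
    obtain ⟨j, hj, hj'⟩ := Finset.not_subset.1 hsub
    refine (Finset.prod_eq_zero (Finset.mem_univ j) (hD.mixed _ i 0 ?_ ?_)).symm
    · simpa [he] using hj
    · rw [Sum.isRight_map, ← Sum.not_isLeft]
      simpa [he] using hj'

lemma HasBorderRankLE.kron_kpow_of_le {T : Tensor ι} {S : Tensor κ} {y : ∀ i, ι i}
    {z : ∀ i, κ i} (hy : T y = 1) (hz : S z = 1) {m n m' n' r : ℕ} (hm : m ≤ m') (hn : n ≤ n')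
    (h : HasBorderRankLE (kron (Subadditivity.kpow T m') (Subadditivity.kpow S n')) r) :
    HasBorderRankLE (kron (Subadditivity.kpow T m) (Subadditivity.kpow S n)) r := by
  obtain ⟨s, rfl⟩ := Nat.exists_eq_add_of_le hm
  obtain ⟨t, rfl⟩ := Nat.exists_eq_add_of_le hn
  have := h.comp (κ := fun i => (Fin m → ι i) × (Fin n → κ i)) fun i x =>
    (Fin.append x.1 fun _ => y i, Fin.append x.2 fun _ => z i)
  convert this using 1
  funext x
  simp [kron, Subadditivity.kpow, Fin.prod_univ_add, hy, hz]

/-- Asymptotic removal of multiplicities from the `(m + n)`-th power of a direct sum. -/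
lemma IsDirectSum.hasBorderRankLE_kron_kpow [NeZero k] {D : Tensor fun i => ι i ⊕ κ i}
    {T : Tensor ι} {S : Tensor κ} (hD : IsDirectSum D T S) {r : ℕ} (hr : HasBorderRankLE D r)
    {m n c : ℕ} (hc : r ^ (m + n) ≤ (m + n).choose m * c) (M : ℕ) :
    HasBorderRankLE (kron (kpow T (m * M)) (kpow S (n * M))) ((m + n).choose m * c ^ M) := by
  have hcard : Fintype.card {s : Finset (Fin (m + n)) // s.card = m} = (m + n).choose m := by
    simp
  have h := ((hD.hasBorderRankLE hr m n).mono (by rwa [hcard])).kron_kpow_diag M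
  obtain ⟨s, -, hs⟩ := Finset.exists_subset_card_eq
    (s := (Finset.univ : Finset (Fin (m + n)))) (n := m) (by simp)
  have := h.comp (κ := fun i => (Fin (m * M) → ι i) × (Fin (n * M) → κ i))
    fun i x => (x, ⟨s, hs⟩)
  rw [hcard] at this
  convert this using 1
  funext x
  rw [kron, kron, diag_of_forall_eq fun _ => rfl]
  simp [kron]

end DirectSum

lemma add_pow_le_choose_mul (m n : ℕ) :
    (m + n) ^ (m + n) ≤ (m + n + 1) * ((m + n).choose m * m ^ m * n ^ n) := by
  have key (a j : ℕ) : a ^ j * a.factorial ≤ a ^ a * j.factorial := by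
    rcases le_total a j with h | h
    · obtain ⟨b, rfl⟩ := Nat.exists_eq_add_of_le h
      have := Nat.factorial_mul_pow_sub_le_factorial h
      rw [Nat.add_sub_cancel_left] at this
      rw [pow_add, mul_assoc, mul_comm (a ^ b)]
      gcongr
    · obtain ⟨b, rfl⟩ := Nat.exists_eq_add_of_le h
      have h1 := Nat.factorial_mul_descFactorial (Nat.le_add_left b j)
      rw [Nat.add_sub_cancel] at h1
      rw [← h1, pow_add _ j b, mul_assoc, mul_comm (_ ^ b)]
      gcongr
      exact Nat.descFactorial_le_pow _ _
  rw [add_pow]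
  calc _ ≤ ∑ j ∈ Finset.range (m + n + 1), (m + n).choose m * m ^ m * n ^ n := by
        refine Finset.sum_le_sum fun j hj => ?_
        have hj : j ≤ m + n := Nat.lt_succ_iff.1 (Finset.mem_range.1 hj)
        have h1 := Nat.choose_mul_factorial_mul_factorial hj
        have h2 := Nat.choose_mul_factorial_mul_factorial (Nat.le_add_right m n)
        rw [Nat.add_sub_cancel_left] at h2
        have h3 := Nat.mul_le_mul (key m j) (key n (m + n - j))
        refine Nat.le_of_mul_le_mul_right (c := j.factorial * (m + n - j).factorial *
          (m.factorial * n.factorial)) ?_ (by positivity)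
        rw [Nat.cast_id]
        calc _ = ((m + n).choose j * j.factorial * (m + n - j).factorial) *
              (m ^ j * m.factorial * (n ^ (m + n - j) * n.factorial)) := by ring
          _ ≤ ((m + n).choose m * m.factorial * n.factorial) *
              (m ^ m * j.factorial * (n ^ n * (m + n - j).factorial)) := by
            rw [h1, h2]; gcongr
          _ = _ := by ring
    _ = _ := by simp

section Construction

/-- The coordinates of the direct sum of `spider3 2 2 n` and `matTensor4 a`. -/
def spiderSumCoord (n a : ℕ) : Fin 2 ⊕ Fin a → Fin 2 ⊕ Fin a → Fin n ⊕ Fin 1 →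
    (Fin 2 × Fin 2 × Fin n) ⊕ Fin 1 → ℂ
  | .inl x₀, .inl x₁, .inl x₂, .inl x₃ => delta x₃ (x₀, x₁, x₂)
  | .inr x₀, .inr x₁, .inr _, .inr _ => delta x₀ x₁
  | _, _, _, _ => 0

/-- The direct sum of `spider3 2 2 n` and `matTensor4 a`. -/
def spiderSum (n a : ℕ) : Tensor fun i : Fin 4 =>
    ![Fin 2, Fin 2, Fin n, Fin 2 × Fin 2 × Fin n] i ⊕ ![Fin a, Fin a, Fin 1, Fin 1] i :=
  fun x => spiderSumCoord n a (x 0) (x 1) (x 2) (x 3)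

lemma isDirectSum_spiderSum (n a : ℕ) :
    IsDirectSum (spiderSum n a) (spider3 2 2 n) (matTensor4 a) where
  inl _ := rfl
  inr _ := rfl
  mixed x i j hi hj := by
    unfold spiderSum
    rcases h0 : x 0 with x₀ | x₀ <;> rcases h1 : x 1 with x₁ | x₁ <;>
      rcases h2 : x 2 with x₂ | x₂ <;> rcases h3 : x 3 with x₃ | x₃ <;> try rfl
    · fin_cases j <;> simp_all <;> cases hj
    · fin_cases i <;> simp_all <;> cases hi

/-- Weights of zero sum with two dual families orthogonal to the constants. -/
lemma exists_weights (a : ℕ) : ∃ (t : Fin (a + 2) → ℂ) (u v : Fin a → Fin (a + 2) → ℂ),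
    ∑ l, t l = 0 ∧ (∀ j, ∑ l, u j l * t l = 0) ∧ (∀ j, ∑ l, v j l * t l = 0) ∧
      ∀ j j', ∑ l, u j l * v j' l * t l = delta j j' := by
  have ha : (a + 1 : ℂ) ≠ 0 := by exact_mod_cast Nat.succ_ne_zero a
  refine ⟨Fin.cons 1 (Fin.cons (-(a + 1)) fun _ => 1),
    fun j => Fin.cons (-1) (Fin.cons 0 (Pi.single j 1)),
    fun j => Fin.cons 0 (Fin.cons (1 / (a + 1)) (Pi.single j 1)), ?_, fun j => ?_, fun j => ?_,
    fun j j' => ?_⟩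
  · simp [Fin.sum_univ_succ]
  · simp [Fin.sum_univ_succ]
  · simp [Fin.sum_univ_succ]
    field_simp
    ring
  · simp [Fin.sum_univ_succ, delta, Pi.single_apply, eq_comm]

/-- The sign attached to an index in `Fin 2`. -/
def sgn (i : Fin 2) : ℂ := if i = 0 then 1 else -1

lemma sum_sgn : ∑ i, sgn i = 0 := by simp [sgn]

lemma sgn_mul_self (i : Fin 2) : sgn i * sgn i = 1 := by
  unfold sgn; split_ifs <;> norm_num

lemma sum_mul_mul {I J K : Type} [Fintype I] [Fintype J] [Fintype K] (f : I → ℂ) (g : J → ℂ)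
    (h : K → ℂ) :
    ∑ i : I × J × K, f i.1 * g i.2.1 * h i.2.2 = (∑ i, f i) * (∑ j, g j) * ∑ l, h l := by
  simp only [Fintype.sum_prod_type, ← Finset.mul_sum, ← Finset.sum_mul]

lemma exists_tendsto_spiderSumCoord (a : ℕ) :
    ∃ (A B : ℂ → Option (Fin 2 × Fin 2 × Fin (a + 2)) → Fin 2 ⊕ Fin a → ℂ)
      (C : ℂ → Option (Fin 2 × Fin 2 × Fin (a + 2)) → Fin (a + 2) ⊕ Fin 1 → ℂ)
      (W : ℂ → Option (Fin 2 × Fin 2 × Fin (a + 2)) →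
        (Fin 2 × Fin 2 × Fin (a + 2)) ⊕ Fin 1 → ℂ),
      ∀ x₀ x₁ x₂ x₃, Filter.Tendsto
        (fun e => ∑ i, A e i x₀ * B e i x₁ * C e i x₂ * W e i x₃) (nhdsWithin 0 {0}ᶜ)
        (nhds (spiderSumCoord (a + 2) a x₀ x₁ x₂ x₃)) := by
  obtain ⟨t, u, v, ht, hu, hv, huv⟩ := exists_weights a
  refine ⟨fun e i => i.elim (Sum.elim 1 0) fun i =>
      Sum.elim (fun x => if i.1 = x then 1 else 0) fun j => e * (sgn i.1 * u j i.2.2),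
    fun e i => i.elim (Sum.elim 1 0) fun i =>
      Sum.elim (fun x => if i.2.1 = x then 1 else 0) fun j => e * (sgn i.2.1 * v j i.2.2),
    fun e i => i.elim (Sum.elim 1 0) fun i =>
      Sum.elim (fun x => if i.2.2 = x then 1 else 0)
        fun _ => e * (sgn i.1 * sgn i.2.1 * t i.2.2 / 4),
    fun e i => i.elim (Sum.elim 0 fun _ => -(e ^ 3)⁻¹) fun i =>
      Sum.elim (fun x => if i = x then 1 else 0) fun _ => (e ^ 3)⁻¹,
    fun x₀ x₁ x₂ x₃ => ?_⟩
  have hconst {f : ℂ → ℂ} {c : ℂ} (h : ∀ e ≠ 0, f e = c) :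
      Filter.Tendsto f (nhdsWithin 0 {0}ᶜ) (nhds c) :=
    tendsto_const_nhds.congr' <| by
      filter_upwards [self_mem_nhdsWithin] with e he using (h e he).symm
  have hcont {f : ℂ → ℂ} {c : ℂ} (hc : Continuous f) (h0 : f 0 = c) :
      Filter.Tendsto f (nhdsWithin 0 {0}ᶜ) (nhds c) :=
    h0 ▸ (hc.tendsto 0).mono_left nhdsWithin_le_nhds
  simp only [Fintype.sum_option, Option.elim_none, Option.elim_some]
  rcases x₃ with x₃ | x₃
  · simp only [Sum.elim_inl, Pi.zero_apply, mul_zero, zero_add, mul_ite, mul_one,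
      Finset.sum_ite_eq', Finset.mem_univ, if_true]
    rcases x₀ with x₀ | x₀ <;> rcases x₁ with x₁ | x₁ <;> rcases x₂ with x₂ | x₂ <;>
      simp only [Sum.elim_inl, Sum.elim_inr] <;> refine hcont (by fun_prop) ?_ <;>
      simp only [spiderSumCoord, zero_mul, mul_zero]
    obtain ⟨y₀, y₁, y₂⟩ := x₃
    by_cases h0 : y₀ = x₀ <;> by_cases h1 : y₁ = x₁ <;> by_cases h2 : y₂ = x₂ <;>
      simp [delta, h0, h1, h2]
  · refine hconst fun e he => ?_
    rcases x₀ with x₀ | x₀ <;> rcases x₁ with x₁ | x₁ <;> rcases x₂ with x₂ | x₂ <;>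
      simp only [Sum.elim_inl, Sum.elim_inr, Pi.zero_apply, Pi.one_apply, mul_zero, zero_mul,
        zero_add, mul_one, spiderSumCoord]
    · rw [← Finset.sum_mul, sum_mul_mul (fun i => if i = x₀ then (1 : ℂ) else 0)
        (fun i => if i = x₁ then (1 : ℂ) else 0) fun i => if i = x₂ then (1 : ℂ) else 0]
      simp
    · have := sum_mul_mul (fun i => if i = x₀ then sgn i else 0)
        (fun i => if i = x₁ then sgn i else 0) fun l => e * (e ^ 3)⁻¹ / 4 * t l
      rw [← Finset.mul_sum, ht, mul_zero, mul_zero] at this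
      refine Eq.trans (Finset.sum_congr rfl fun i _ => ?_) this
      split_ifs <;> ring
    · have := sum_mul_mul (fun i => if i = x₀ then (1 : ℂ) else 0)
        sgn fun l => e * (e ^ 3)⁻¹ * (if l = x₂ then v x₁ l else 0)
      rw [sum_sgn, mul_zero, zero_mul] at this
      refine Eq.trans (Finset.sum_congr rfl fun i _ => ?_) this
      split_ifs <;> ring
    · have := sum_mul_mul (fun i => if i = x₀ then sgn i else 0)
        (fun i => sgn i * sgn i) fun l => e * e * (e ^ 3)⁻¹ / 4 * (v x₁ l * t l)
      rw [← Finset.mul_sum, hv, mul_zero, mul_zero] at this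
      refine Eq.trans (Finset.sum_congr rfl fun i _ => ?_) this
      split_ifs <;> ring
    · have := sum_mul_mul sgn (fun i => if i = x₁ then (1 : ℂ) else 0)
        fun l => e * (e ^ 3)⁻¹ * (if l = x₂ then u x₀ l else 0)
      rw [sum_sgn, zero_mul, zero_mul] at this
      refine Eq.trans (Finset.sum_congr rfl fun i _ => ?_) this
      split_ifs <;> ring
    · have := sum_mul_mul (fun i => sgn i * sgn i) (fun i => if i = x₁ then sgn i else 0)
        fun l => e * e * (e ^ 3)⁻¹ / 4 * (u x₀ l * t l)
      rw [← Finset.mul_sum, hu, mul_zero, mul_zero] at this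
      refine Eq.trans (Finset.sum_congr rfl fun i _ => ?_) this
      split_ifs <;> ring
    · have := sum_mul_mul sgn sgn
        fun l => e * e * (e ^ 3)⁻¹ * (if l = x₂ then u x₀ l * v x₁ l else 0)
      rw [sum_sgn, zero_mul, zero_mul] at this
      refine Eq.trans (Finset.sum_congr rfl fun i _ => ?_) this
      split_ifs <;> ring
    · have := sum_mul_mul (fun i => sgn i * sgn i) (fun i => sgn i * sgn i)
        fun l => e * e * e * (e ^ 3)⁻¹ / 4 * (u x₀ l * v x₁ l * t l)
      rw [← Finset.mul_sum, huv] at this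
      simp only [sgn_mul_self] at this
      refine Eq.trans (Finset.sum_congr rfl fun i _ => ?_) (this.trans ?_)
      · linear_combination (e * e * e * (e ^ 3)⁻¹ / 4 * (u x₀ i.2.2 * v x₁ i.2.2 * t i.2.2)) *
          (sgn i.2.1 * sgn i.2.1 * sgn_mul_self i.1 + sgn_mul_self i.2.1)
      · simp
        field_simp
        norm_num

lemma hasBorderRankLE_spiderSum (a : ℕ) :
    HasBorderRankLE (spiderSum (a + 2) a) (4 * (a + 2) + 1) := by
  obtain ⟨A, B, C, W, h⟩ := exists_tendsto_spiderSumCoord a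
  refine mem_closure_of_tendsto
    (tendsto_pi_nhds.2 fun x => h (x 0) (x 1) (x 2) (x 3))
    (Filter.Eventually.of_forall fun e => ?_)
  have := hasRankLE_sum (ι := fun i : Fin 4 => ![Fin 2, Fin 2, Fin (a + 2),
    Fin 2 × Fin 2 × Fin (a + 2)] i ⊕ ![Fin a, Fin a, Fin 1, Fin 1] i)
    fun (i : Option (Fin 2 × Fin 2 × Fin (a + 2))) l => match l with
      | 0 => A e i | 1 => B e i | 2 => C e i | 3 => W e i
  change HasRankLE _ _
  convert this using 1
  · funext x
    simp only [Fin.prod_univ_four]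
  · simp; ring

end Construction

section Asymptotics

lemma two_rpow_binEnt_pow {m n : ℕ} (hm : 0 < m) (hn : 0 < n) {p : ℚ} (hp : p * (m + n) = m) :
    ((2 : ℝ) ^ binEnt p) ^ (m + n) * ((m : ℝ) ^ m * (n : ℝ) ^ n) = ((m + n : ℕ) : ℝ) ^ (m + n) := by
  have hm' : (0 : ℝ) < m := by exact_mod_cast hm
  have hn' : (0 : ℝ) < n := by exact_mod_cast hn
  have hpR : (p : ℝ) = m / (m + n) := by
    rw [eq_div_iff (by positivity)]
    exact_mod_cast hp
  have hqR : 1 - (p : ℝ) = n / (m + n) := by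
    rw [hpR]; field_simp; ring
  refine Real.log_injOn_pos (Set.mem_Ioi.2 (by positivity)) (Set.mem_Ioi.2 (by positivity)) ?_
  have h2 : Real.log 2 ≠ 0 := (Real.log_pos one_lt_two).ne'
  rw [Real.log_mul (by positivity) (by positivity), Real.log_mul (by positivity) (by positivity),
    Real.log_pow, Real.log_pow, Real.log_pow, Real.log_pow, Real.log_rpow two_pos, binEnt, hqR, hpR,
    Real.logb, Real.logb, Real.log_div hm'.ne' (by positivity), Real.log_div hn'.ne' (by positivity)]
  push_cast
  field_simp
  ring

lemma two_rpow_binEnt_pow_le {m n : ℕ} (hm : 0 < m) (hn : 0 < n) {p : ℚ}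
    (hp : p * (m + n) = m) :
    ((2 : ℝ) ^ binEnt p) ^ (m + n) ≤ (m + n + 1 : ℕ) * ((m + n).choose m : ℝ) := by
  have hpos : (0 : ℝ) < (m : ℝ) ^ m * (n : ℝ) ^ n := by positivity
  refine le_of_mul_le_mul_right ?_ hpos
  rw [two_rpow_binEnt_pow hm hn hp]
  have := add_pow_le_choose_mul m n
  calc ((m + n : ℕ) : ℝ) ^ (m + n)
      ≤ ((m + n + 1 : ℕ) : ℝ) * (((m + n).choose m : ℝ) * (m : ℝ) ^ m * (n : ℝ) ^ n) := by
        exact_mod_cast this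
    _ = _ := by ring

lemma exists_le_choose_mul {m n r : ℕ} (hm : 0 < m) (hn : 0 < n) (hr : 2 ≤ r) {p : ℚ}
    (hp : p * (m + n) = m) :
    ∃ c : ℕ, r ^ (m + n) ≤ (m + n).choose m * c ∧
      (c : ℝ) ≤ 2 * (m + n + 1 : ℕ) * ((r : ℝ) * (2 : ℝ) ^ (-binEnt p)) ^ (m + n) := by
  have hq : 0 < (m + n).choose m := Nat.choose_pos (Nat.le_add_right m n)
  refine ⟨r ^ (m + n) / (m + n).choose m + 1, (Nat.lt_mul_div_succ _ hq).le, ?_⟩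
  have hH : (0 : ℝ) < ((2 : ℝ) ^ binEnt p) ^ (m + n) := by positivity
  have hqr : (m + n).choose m ≤ r ^ (m + n) :=
    (Nat.choose_le_two_pow _ _).trans (Nat.pow_le_pow_left hr _)
  have hq' : (0 : ℝ) < (m + n).choose m := by exact_mod_cast hq
  have h1 : ((r ^ (m + n) / (m + n).choose m + 1 : ℕ) : ℝ) ≤
      2 * ((r : ℝ) ^ (m + n) / (m + n).choose m) := by
    have h2 : ((r ^ (m + n) / (m + n).choose m : ℕ) : ℝ) ≤
        (r : ℝ) ^ (m + n) / (m + n).choose m := by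
      exact_mod_cast (Nat.cast_div_le (α := ℝ) (m := r ^ (m + n)) (n := (m + n).choose m))
    have h3 : 1 ≤ (r : ℝ) ^ (m + n) / (m + n).choose m := by
      rw [one_le_div hq']; exact_mod_cast hqr
    push_cast at h2 ⊢
    linarith
  refine h1.trans ?_
  rw [mul_pow, Real.rpow_neg two_pos.le, inv_pow, mul_assoc 2]
  gcongr
  rw [div_le_iff₀ hq', ← div_eq_mul_inv, mul_div_assoc', div_mul_eq_mul_div, le_div_iff₀ hH]
  calc (r : ℝ) ^ (m + n) * ((2 : ℝ) ^ binEnt p) ^ (m + n)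
      ≤ (r : ℝ) ^ (m + n) * ((m + n + 1 : ℕ) * ((m + n).choose m : ℝ)) := by
        gcongr; exact two_rpow_binEnt_pow_le hm hn hp
    _ = _ := by ring

lemma eventually_linear_mul_pow_le {B C : ℝ} (hC : 0 < C) (hB : C < B) :
    ∀ᶠ N : ℕ in Filter.atTop, 2 * ((N + 1 : ℕ) : ℝ) * C ^ N ≤ B ^ N := by
  have hBpos := hC.trans hB
  have h := tendsto_self_mul_const_pow_of_lt_one (r := C / B) (by positivity)
    ((div_lt_one hBpos).2 hB)
  filter_upwards [h.eventually (gt_mem_nhds (show (0 : ℝ) < 1 / 4 by norm_num)),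
    Filter.eventually_ge_atTop 1] with N hN hN1
  have hN1' : (1 : ℝ) ≤ N := by exact_mod_cast hN1
  rw [div_pow, mul_div_assoc', div_lt_iff₀ (by positivity)] at hN
  have := mul_le_mul_of_nonneg_right hN1' (pow_pos hC N).le
  push_cast
  linarith

lemma limsup_rpow_inv_le {l : Filter ℕ} [l.NeBot] (hl : l ≤ Filter.atTop) {g : ℕ → ℕ} {C : ℝ}
    (hC : 0 < C) (h : ∀ B, C < B → ∃ K : ℝ, 0 < K ∧ ∀ᶠ N in l, (g N : ℝ) ≤ K * B ^ N) :
    Filter.limsup (fun N : ℕ => (g N : ℝ) ^ ((1 : ℝ) / (N : ℝ))) l ≤ C := by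
  refine le_of_forall_gt_imp_ge_of_dense fun B' hB' => ?_
  obtain ⟨B, hCB, hBB'⟩ := exists_between hB'
  obtain ⟨K, hK, hg⟩ := h B hCB
  have hB := hC.trans hCB
  refine Filter.limsup_le_of_le (Filter.isCoboundedUnder_le_of_le l (x := 0)
    fun N => by positivity) ?_
  have hlim := (tendsto_pow_atTop_atTop_of_one_lt ((one_lt_div hB).2 hBB')).mono_left hl
  filter_upwards [hg, hlim.eventually_ge_atTop K, hl (Filter.eventually_ge_atTop 1)]
    with N hN hKN hN1
  rw [div_pow, le_div_iff₀ (by positivity)] at hKN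
  rw [one_div]
  calc (g N : ℝ) ^ ((N : ℝ)⁻¹) ≤ (B' ^ N) ^ ((N : ℝ)⁻¹) := by
        gcongr; exact hN.trans hKN
    _ = B' := Real.pow_rpow_inv_natCast (hB.trans hBB').le (by omega)

/-- Exponential rate of the border rank of `T^{⊠pN} ⊠ S^{⊠(1-p)N}` when the direct sum of `T` and
`S` has border rank at most `r`. -/
lemma IsDirectSum.exists_borderRank_le {k : ℕ} [NeZero k] {ι κ : Fin k → Type}
    {D : Tensor fun i => ι i ⊕ κ i} {T : Tensor ι} {S : Tensor κ} (hD : IsDirectSum D T S)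
    {y : ∀ i, ι i} {z : ∀ i, κ i} (hy : T y = 1) (hz : S z = 1) {r : ℕ} (hr : 2 ≤ r)
    (hDr : HasBorderRankLE D r) {m n : ℕ} (hm : 0 < m) (hn : 0 < n) {p : ℚ}
    (hp : p * (m + n) = m) {B : ℝ} (hB : (r : ℝ) * (2 : ℝ) ^ (-binEnt p) < B) :
    ∃ K : ℝ, 0 < K ∧ ∀ l : ℕ,
      (borderRank (kron (kpow T (m * l)) (kpow S (n * l))) : ℝ) ≤ K * B ^ ((m + n) * l) := by
  have hr0 : (0 : ℝ) < r := by exact_mod_cast two_pos.trans_le hr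
  obtain ⟨N₀, hN₀⟩ := Filter.eventually_atTop.1 (eventually_linear_mul_pow_le (by positivity) hB)
  set s := N₀ + 1 with hs
  have hB0 : 0 < B := lt_trans (by positivity) hB
  have hms : 0 < m * s := by positivity
  have hns : 0 < n * s := by positivity
  obtain ⟨c, hc, hc'⟩ := exists_le_choose_mul (r := r) hms hns hr (p := p) (by
    push_cast; linear_combination (s : ℚ) * hp)
  have hle : N₀ ≤ m * s + n * s := by nlinarith
  replace hc' := hc'.trans (hN₀ _ hle)
  have hc1 : (1 : ℝ) ≤ c := by
    have : c ≠ 0 := by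
      rintro rfl
      have : 0 < r ^ (m * s + n * s) := by positivity
      omega
    exact_mod_cast Nat.one_le_iff_ne_zero.2 this
  have hB1 : 1 ≤ B := by
    by_contra! h
    exact absurd (hc1.trans hc') (not_le.2 (pow_lt_one₀ hB0.le h (by omega)))
  set q := (m * s + n * s).choose (m * s)
  have hq : 0 < q := Nat.choose_pos (Nat.le_add_right _ _)
  refine ⟨q * B ^ (m * s + n * s), by positivity, fun l => ?_⟩
  have hl : l ≤ s * (l / s + 1) := (Nat.lt_mul_div_succ l (by omega)).le
  have hls : s * (l / s) ≤ l := Nat.mul_div_le l s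
  have hrank := ((hD.hasBorderRankLE_kron_kpow hDr hc (l / s + 1)).kron_kpow_of_le hy hz
    (m := m * l) (n := n * l) (by rw [mul_assoc]; gcongr)
    (by rw [mul_assoc]; gcongr)).borderRank_le
  calc (borderRank (kron (kpow T (m * l)) (kpow S (n * l))) : ℝ)
      ≤ q * (c : ℝ) ^ (l / s + 1) := by exact_mod_cast hrank
    _ ≤ q * (B ^ (m * s + n * s)) ^ (l / s + 1) := by gcongr
    _ = q * B ^ (m * s + n * s) * B ^ ((m + n) * (s * (l / s))) := by ring
    _ ≤ q * B ^ (m * s + n * s) * B ^ ((m + n) * l) := by gcongr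

end Asymptotics

lemma spider3_zero (a : ℕ) : ∃ y, spider3 2 2 (a + 2) y = 1 :=
  ⟨fun i => match i with
    | 0 => (0 : Fin 2) | 1 => (0 : Fin 2) | 2 => (0 : Fin (a + 2))
    | 3 => ((0, 0, 0) : Fin 2 × Fin 2 × Fin (a + 2)), by simp [spider3, delta]⟩

lemma matTensor4_zero {a : ℕ} (ha : 0 < a) : ∃ z, matTensor4 a z = 1 :=
  ⟨fun i => match i with
    | 0 => (⟨0, ha⟩ : Fin a) | 1 => (⟨0, ha⟩ : Fin a) | 2 => (0 : Fin 1) | 3 => (0 : Fin 1),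
    by simp [matTensor4, delta]⟩

/-- Theorem 4.1: exponent of the extended matrix multiplication
tensor. For `a ≥ 2` and rational `p ∈ (0,1)`, the limit superior, over integers
`N → ∞` with `pN ∈ ℕ`, of `R̲(T₁^{⊠pN} ⊠ T₂^{⊠(1−p)N})^{1/N}` is at most
`(4(a+2)+1) · 2^{−h(p)}`. -/
theorem exponent_EMaMu (a : ℕ) (ha : 2 ≤ a) (p : ℚ) (hp0 : 0 < p) (hp1 : p < 1) :
    Filter.limsup
      (fun N : ℕ =>
        ((borderRank (kron (kpow (spider3 2 2 (a + 2)) (p * (N : ℚ)).num.toNat)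
            (kpow (matTensor4 a) (N - (p * (N : ℚ)).num.toNat))) : ℝ)) ^ ((1 : ℝ) / (N : ℝ)))
      (pIntFilter p) ≤ ((4 * (a + 2) + 1 : ℕ) : ℝ) * (2 : ℝ) ^ (-binEnt p) := by
  obtain ⟨y, hy⟩ := spider3_zero a
  obtain ⟨z, hz⟩ := matTensor4_zero (a := a) (by omega)
  obtain ⟨m, hm⟩ := Int.eq_ofNat_of_zero_le (Rat.num_nonneg.2 hp0.le)
  have hd : (0 : ℚ) < p.den := by exact_mod_cast p.den_pos
  have hpd : p * p.den = m := by
    have := Rat.mul_den_eq_num p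
    rw [hm] at this
    exact_mod_cast this
  have hm0 : 0 < m := by
    have : (0 : ℚ) < m := hpd ▸ mul_pos hp0 hd
    exact_mod_cast this
  have hmd : m < p.den := by
    have : (m : ℚ) < p.den := hpd ▸ (mul_lt_iff_lt_one_left hd).2 hp1
    exact_mod_cast this
  obtain ⟨n, hn⟩ := Nat.exists_eq_add_of_lt hmd
  have hcop : Nat.Coprime m p.den := by simpa [hm] using p.reduced
  have hdvd {N : ℕ} (hN : ∃ j : ℕ, (j : ℚ) = p * N) : p.den ∣ N := by
    obtain ⟨j, hj⟩ := hN
    refine hcop.symm.dvd_of_dvd_mul_left (Dvd.intro_left j ?_)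
    have : (j * p.den : ℚ) = m * N := by rw [hj, ← hpd]; ring
    exact_mod_cast this
  have : (pIntFilter p).NeBot := by
    refine Filter.frequently_mem_iff_neBot.1 (Filter.frequently_atTop.2 fun N =>
      ⟨p.den * N, Nat.le_mul_of_pos_left N p.den_pos, m * N, ?_⟩)
    push_cast
    rw [← hpd]; ring
  refine limsup_rpow_inv_le (l := pIntFilter p) inf_le_left (by positivity) fun B hB => ?_
  obtain ⟨K, hK, hbound⟩ := (isDirectSum_spiderSum (a + 2) a).exists_borderRank_le hy hz
    (by omega) (hasBorderRankLE_spiderSum a) hm0 (Nat.succ_pos n)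
    (by rw [hn] at hpd; push_cast at hpd ⊢; linear_combination hpd) hB
  refine ⟨K, hK, ?_⟩
  filter_upwards [Filter.mem_inf_of_right (Filter.mem_principal_self _)] with N hN
  obtain ⟨l, rfl⟩ := hdvd hN
  have hnum : (p * ((p.den * l : ℕ) : ℚ)).num.toNat = m * l := by
    have : p * ((p.den * l : ℕ) : ℚ) = ((m * l : ℕ) : ℚ) := by
      push_cast; rw [← hpd]; ring
    rw [this, Rat.num_natCast, Int.toNat_natCast]
  have hsub : p.den * l - m * l = (n + 1) * l := by
    rw [← Nat.sub_mul, hn]; congr 1; omega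
  rw [hnum, hsub, hn]
  exact hbound l

end
end Subadditivity
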